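/- arXiv:2408.03742 — 2 statements merged into one kernel-verified Lean document; each statement's English description precedes it below -/
import Mathlib

section
/- For every n ≥ 300 and all integers w, i with 0 ≤ w ≤ 0.16·n and 0 ≤ i ≤ n/2, the Krawtchouk polynomial satisfies |K_w(i)| ≤ binom(n,w)·(1 − 2w/n)^i. -/
open Finset Filter
open scoped Classical BigOperators Topology

abbrev BV (n : ℕ) := Fin n → ZMod 2

def wt {n : ℕ} (x : BV n) : ℕ := (Finset.univ.filter (fun i => x i ≠ 0)).card

def dotp {n : ℕ} (x y : BV n) : ZMod 2 := ∑ i, x i * y i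

def IsPMF {α : Type*} [Fintype α] (P : α → ℝ) : Prop :=
  (∀ x, 0 ≤ P x) ∧ ∑ x, P x = 1

noncomputable def dTV {α : Type*} [Fintype α] (P Q : α → ℝ) : ℝ :=
  (1/2) * ∑ x, |P x - Q x|

noncomputable def unif (α : Type*) [Fintype α] : α → ℝ := fun _ => 1 / (Fintype.card α)

noncomputable def unifOn {α : Type*} [Fintype α] (S : Set α) : α → ℝ :=
  fun x => if x ∈ S then 1 / (Nat.card S) else 0

noncomputable def conv {n : ℕ} (P Q : BV n → ℝ) : BV n → ℝ :=
  fun x => ∑ y, P y * Q (x - y)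

noncomputable def FT {n : ℕ} (f : BV n → ℝ) : BV n → ℝ :=
  fun y => (1 / 2^n) * ∑ x, f x * (if dotp x y = 0 then (1:ℝ) else -1)

noncomputable def Kraw (n w i : ℕ) : ℝ :=
  ∑ j ∈ Finset.range (w+1), (-1:ℝ)^j * (Nat.choose i j) * (Nat.choose (n-i) (w-j))

def Vball (n t : ℕ) : ℕ := ∑ j ∈ Finset.range (t+1), Nat.choose n j

noncomputable def pmfMap {m n : ℕ} (G : Matrix (Fin m) (Fin n) (ZMod 2)) (P : BV n → ℝ) :
    BV m → ℝ :=
  fun u => ∑ z ∈ Finset.univ.filter (fun z => G.mulVec z = u), P z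

noncomputable def biasOf {n : ℕ} (e : BV n) (P : BV n → ℝ) : ℝ :=
  1/2 - ∑ z ∈ Finset.univ.filter (fun z => dotp e z = 1), P z

noncomputable def bitPMF {n : ℕ} (e : BV n) (P : BV n → ℝ) : ZMod 2 → ℝ :=
  fun b => ∑ z ∈ Finset.univ.filter (fun z => dotp e z = b), P z

noncomputable def jointPMF {m n : ℕ} (G : Matrix (Fin m) (Fin n) (ZMod 2)) (e : BV n)
    (P : BV n → ℝ) : BV m × ZMod 2 → ℝ :=
  fun p => ∑ z ∈ Finset.univ.filter (fun z => G.mulVec z = p.1 ∧ dotp e z = p.2), P z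

noncomputable def prodPMF {m : ℕ} (Pb : ZMod 2 → ℝ) : BV m × ZMod 2 → ℝ :=
  fun p => (1 / 2^m) * Pb p.2

def dualSet {n : ℕ} (C : Set (BV n)) : Set (BV n) := {y | ∀ c ∈ C, dotp y c = 0}

def rowSpan {k n : ℕ} (G : Matrix (Fin k) (Fin n) (ZMod 2)) : Submodule (ZMod 2) (BV n) :=
  Submodule.span (ZMod 2) (Set.range (fun i => G i))

/-- The generating polynomial `∑ w, K_w(i) X ^ w` of the Krawtchouk values at `i`. -/
noncomputable def krawGen (n i : ℕ) : Polynomial ℝ :=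
  (1 - Polynomial.X) ^ i * (1 + Polynomial.X) ^ (n - i)

lemma coeff_one_sub_X_pow_real (i j : ℕ) :
    ((1 - Polynomial.X : Polynomial ℝ) ^ i).coeff j = (-1) ^ j * (i.choose j : ℝ) := by
  have h : (1 - Polynomial.X : Polynomial ℝ) ^ i
      = ((1 + Polynomial.X : Polynomial ℝ) ^ i).comp (Polynomial.C (-1) * Polynomial.X) := by
    simp [sub_eq_add_neg]
  rw [h, Polynomial.comp_C_mul_X_coeff, Polynomial.coeff_one_add_X_pow, mul_comm]

lemma coeff_krawGen (n w i : ℕ) : (krawGen n i).coeff w = Kraw n w i := by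
  rw [krawGen, Polynomial.coeff_mul, Finset.Nat.sum_antidiagonal_eq_sum_range_succ_mk, Kraw]
  simp only [coeff_one_sub_X_pow_real, Polynomial.coeff_one_add_X_pow]

lemma natDegree_krawGen_le {n i : ℕ} (hi : i ≤ n) : (krawGen n i).natDegree ≤ n := by
  have h : (krawGen n i).natDegree ≤ i * 1 + (n - i) * 1 := by
    refine Polynomial.natDegree_mul_le.trans (add_le_add ?_ ?_)
    · refine Polynomial.natDegree_pow_le.trans (Nat.mul_le_mul_left _ ?_)
      compute_degree
    · refine Polynomial.natDegree_pow_le.trans (Nat.mul_le_mul_left _ ?_)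
      compute_degree
  omega

/-- The reciprocity `C(n, i) K_w(i) = C(n, w) K_i(w)`. -/
lemma choose_mul_kraw_comm {n w i : ℕ} (hw : w ≤ n) (hi : i ≤ n) :
    (n.choose i : ℝ) * Kraw n w i = n.choose w * Kraw n i w := by
  have key : ∀ w i : ℕ, w ≤ n → Kraw n w i
      = ∑ j ∈ range (n + 1), if j ≤ w ∧ j ≤ i then
          (-1 : ℝ) ^ j * (i.choose j) * ((n - i).choose (w - j)) else 0 := by
    intro w i hw
    rw [← Finset.sum_filter, Kraw]
    symm
    refine Finset.sum_subset (fun j hj => ?_) (fun j hj hj' => ?_)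
    · simp only [Finset.mem_filter, Finset.mem_range] at hj ⊢
      omega
    · simp only [Finset.mem_filter, Finset.mem_range] at hj hj'
      rw [Nat.choose_eq_zero_of_lt (by omega : i < j)]
      simp
  rw [key w i hw, key i w hi, Finset.mul_sum, Finset.mul_sum]
  refine Finset.sum_congr rfl fun j hj => ?_
  simp only [and_comm (a := j ≤ i)]
  split_ifs with h
  · obtain ⟨a, rfl⟩ := Nat.exists_eq_add_of_le h.1
    obtain ⟨b, rfl⟩ := Nat.exists_eq_add_of_le h.2
    have h1 := Nat.choose_mul (n := n) (k := j + b) (s := j) (by omega)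
    have h2 := Nat.choose_mul (n := n) (k := j + a) (s := j) (by omega)
    have h3 := Nat.choose_mul (n := n - j) (k := a + b) (s := b) (by omega)
    have h4 := Nat.choose_mul (n := n - j) (k := a + b) (s := a) (by omega)
    have h5 : (a + b).choose a = (a + b).choose b := Nat.choose_symm_add
    simp only [Nat.add_sub_cancel_left, Nat.add_sub_cancel, ← Nat.sub_add_eq] at h1 h2 h3 h4 ⊢
    have h6 : n.choose (j + b) * ((j + b).choose j * (n - (j + b)).choose a)
        = n.choose (j + a) * ((j + a).choose j * (n - (j + a)).choose b) := by
      rw [← mul_assoc, ← mul_assoc, h1, h2, mul_assoc, mul_assoc, ← h3, ← h4, h5]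
    have h7 : (n.choose (j + b) : ℝ) * ((j + b).choose j * (n - (j + b)).choose a)
        = n.choose (j + a) * ((j + a).choose j * (n - (j + a)).choose b) := by exact_mod_cast h6
    linear_combination (-1 : ℝ) ^ j * h7
  · simp

/-- The three-term recurrence in the degree. -/
lemma kraw_recurrence {n w : ℕ} (hw : w ≤ n) (i : ℕ) :
    ((i : ℝ) + 2) * Kraw n (i + 2) w = (n - 2 * w) * Kraw n (i + 1) w - (n - i) * Kraw n i w := by
  have hd : (1 - Polynomial.X ^ 2 : Polynomial ℝ) * Polynomial.derivative (krawGen n w)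
      = (Polynomial.C (n - 2 * w : ℝ) - Polynomial.C (n : ℝ) * Polynomial.X) * krawGen n w := by
    obtain ⟨b, rfl⟩ := Nat.exists_eq_add_of_le hw
    simp only [krawGen, Nat.add_sub_cancel_left]
    simp only [Polynomial.derivative_mul, Polynomial.derivative_pow, Polynomial.derivative_sub,
      Polynomial.derivative_add, Polynomial.derivative_one, Polynomial.derivative_X]
    have hp : ∀ (p : Polynomial ℝ) (k : ℕ), (k : Polynomial ℝ) * p ^ (k - 1) * p = k * p ^ k := by
      intro p k
      cases k with
      | zero => simp
      | succ k => rw [Nat.add_sub_cancel, mul_assoc, ← pow_succ]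
    have h1 := hp (1 - Polynomial.X) w
    have h2 := hp (1 + Polynomial.X) b
    simp only [map_sub, map_mul, map_natCast, map_ofNat, Nat.cast_add, map_add]
    linear_combination (-(1 + Polynomial.X) * (1 + Polynomial.X) ^ b) * h1
      + ((1 - Polynomial.X) * (1 - Polynomial.X) ^ w) * h2
  have hc := congrArg (fun p => Polynomial.coeff p (i + 1)) hd
  simp only [sub_mul, one_mul, Polynomial.coeff_sub, Polynomial.coeff_C_mul, mul_assoc,
    Polynomial.coeff_X_mul, Polynomial.coeff_derivative, coeff_krawGen] at hc
  have h2 : (Polynomial.X ^ 2 * Polynomial.derivative (krawGen n w)).coeff (i + 1)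
      = i * Kraw n i w := by
    cases i with
    | zero => simp [Polynomial.coeff_X_pow_mul']
    | succ i =>
      rw [show i + 1 + 1 = i + 2 from rfl, Polynomial.coeff_X_pow_mul,
        Polynomial.coeff_derivative, coeff_krawGen]
      push_cast; ring
  rw [h2] at hc
  push_cast at hc
  linear_combination hc

lemma kraw_zero (n w : ℕ) : Kraw n 0 w = 1 := by simp [Kraw]

lemma kraw_one {n w : ℕ} (hw : w ≤ n) : Kraw n 1 w = n - 2 * w := by
  simp [Kraw, Finset.sum_range_succ, Nat.cast_sub hw]; ring

/-- The Krawtchouk matrix squares to `2 ^ n`; this is its diagonal. -/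
lemma sum_kraw_mul_kraw {n w : ℕ} (hw : w ≤ n) :
    ∑ i ∈ range (n + 1), Kraw n i w * Kraw n w i = 2 ^ n := by
  have hpoly : ∑ i ∈ range (n + 1), Polynomial.C (Kraw n i w) * krawGen n i
      = Polynomial.C (2 ^ n : ℝ) * Polynomial.X ^ w := by
    refine Polynomial.eq_of_infinite_eval_eq _ _ ((Set.Ioi_infinite (0 : ℝ)).mono fun x hx => ?_)
    have hx : (0 : ℝ) < x := hx
    have he := Polynomial.eval_eq_sum_range'
      (Nat.lt_succ_of_le (natDegree_krawGen_le hw)) ((1 - x) / (1 + x))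
    simp only [coeff_krawGen] at he
    have hl : (1 + x) ^ n * (krawGen n w).eval ((1 - x) / (1 + x)) = 2 ^ n * x ^ w := by
      obtain ⟨b, rfl⟩ := Nat.exists_eq_add_of_le hw
      simp only [krawGen, Polynomial.eval_mul, Polynomial.eval_pow, Polynomial.eval_sub,
        Polynomial.eval_add, Polynomial.eval_one, Polynomial.eval_X, Nat.add_sub_cancel_left]
      have e1 : (1 + x) * (1 - (1 - x) / (1 + x)) = 2 * x := by field_simp; ring
      have e2 : (1 + x) * (1 + (1 - x) / (1 + x)) = 2 := by field_simp; ring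
      rw [pow_add, mul_mul_mul_comm, ← mul_pow, ← mul_pow, e1, e2, mul_pow, pow_add]
      ring
    simp only [Set.mem_ofPred_eq, Polynomial.eval_finsetSum, Polynomial.eval_mul,
      Polynomial.eval_C, Polynomial.eval_pow, Polynomial.eval_X]
    rw [← hl, he, Finset.mul_sum]
    refine Finset.sum_congr rfl fun i hi => ?_
    have hin : i ≤ n := by simpa [Nat.lt_succ_iff] using hi
    obtain ⟨b, rfl⟩ := Nat.exists_eq_add_of_le hin
    simp only [krawGen, Polynomial.eval_mul, Polynomial.eval_pow, Polynomial.eval_sub,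
      Polynomial.eval_add, Polynomial.eval_one, Polynomial.eval_X, Nat.add_sub_cancel_left]
    rw [div_pow, pow_add]
    field_simp
  have hc := congrArg (fun p => Polynomial.coeff p w) hpoly
  simpa only [Polynomial.finsetSum_coeff, Polynomial.coeff_C_mul, coeff_krawGen,
    Polynomial.coeff_X_pow_self, mul_one] using hc

/-- The bound on a Krawtchouk value given by the orthogonality relation. -/
lemma choose_mul_kraw_sq_le {n w i : ℕ} (hw : w ≤ n) (hi : i ≤ n) :
    (n.choose i : ℝ) * Kraw n w i ^ 2 ≤ 2 ^ n * n.choose w := by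
  have hterm : ∀ j ∈ range (n + 1), (n.choose w : ℝ) * (Kraw n j w * Kraw n w j)
      = n.choose j * Kraw n w j ^ 2 := by
    intro j hj
    have hjn : j ≤ n := by simpa [Nat.lt_succ_iff] using hj
    linear_combination (-Kraw n w j) * choose_mul_kraw_comm hw hjn
  have hsum := congrArg (fun t => (n.choose w : ℝ) * t) (sum_kraw_mul_kraw hw)
  simp only [Finset.mul_sum] at hsum
  rw [Finset.sum_congr rfl hterm] at hsum
  have := Finset.single_le_sum (f := fun j => (n.choose j : ℝ) * Kraw n w j ^ 2)
    (fun j _ => by positivity) (Finset.mem_range.2 (Nat.lt_succ_of_le hi))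
  linarith

/-- Below the turning point `4 i (n - i) = m ^ 2`, a solution of the normalized Krawtchouk recurrence
stays positive and decays at least geometrically. -/
lemma recurrence_pos_le_pow {n i : ℕ} {m : ℝ} {k : ℕ → ℝ} (hn : 0 < n) (hm : 0 < m) (hmn : m ≤ n)
    (hi : 2 * i ≤ n) (hdisc : 4 * (i : ℝ) * (n - i) ≤ m ^ 2) (h0 : k 0 = 1) (h1 : n * k 1 = m)
    (hrec : ∀ j, j + 2 ≤ n →
      ((n : ℝ) - j - 1) * k (j + 2) = m * k (j + 1) - (j + 1) * k j) :
    0 < k i ∧ k i ≤ (m / n) ^ i := by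
  have hnR : (0 : ℝ) < n := by exact_mod_cast hn
  have hiR : 2 * (i : ℝ) ≤ n := by exact_mod_cast hi
  have hni : (0 : ℝ) < n - i := by linarith
  have hm2 : m ^ 2 ≤ n ^ 2 := by gcongr
  -- the ratio `R`, a double root of the characteristic equation at the turning point
  obtain ⟨R, hR⟩ : ∃ R, R = m / (2 * (n - i)) := ⟨_, rfl⟩
  have hRpos : 0 < R := by rw [hR]; positivity
  have hRm : 2 * ((n : ℝ) - i) * R = m := by rw [hR]; field_simp
  have hR1 : R ≤ 1 := by rw [hR, div_le_one (by positivity)]; linarith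
  have step : ∀ j, j < i → 0 < k j ∧ k j ≤ (m / n) ^ j ∧ R * k j ≤ k (j + 1) ∧
      n * k (j + 1) ≤ m * k j := by
    intro j
    induction j with
    | zero =>
      intro _
      refine ⟨by simp [h0], by simp [h0], ?_, by simp [h0, h1]⟩
      have : R * n ≤ n * k 1 := by rw [h1, ← hRm]; nlinarith
      rw [h0]; nlinarith
    | succ j ih =>
      intro hj
      obtain ⟨hp, hle, hlo, hhi⟩ := ih (by omega)
      have hjR : (j : ℝ) + 1 ≤ i := by exact_mod_cast hj.le
      have hr := hrec j (by omega)
      have hp1 : 0 < k (j + 1) := lt_of_lt_of_le (by positivity) hlo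
      have hnj : (0 : ℝ) < n - j - 1 := by linarith
      refine ⟨hp1, ?_, ?_, ?_⟩
      · rw [pow_succ]
        have : k (j + 1) ≤ k j * (m / n) := by
          rw [mul_div_assoc', le_div_iff₀ hnR]; linarith
        exact this.trans (by gcongr)
      · have hq : ((n : ℝ) - j - 1) * R ^ 2 - m * R + (j + 1) ≤ 0 := by
          nlinarith [mul_nonneg (sub_nonneg.2 hjR) (sub_nonneg.2 (pow_le_one₀ (n := 2) hRpos.le hR1))]
        have h3 : ((n : ℝ) - j - 1) * (R * k (j + 1)) * R ≤ ((n : ℝ) - j - 1) * k (j + 2) * R := by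
          rw [hr]
          nlinarith [mul_nonneg hp1.le (neg_nonneg.2 hq), Nat.cast_nonneg (α := ℝ) j]
        have h4 := le_of_mul_le_mul_right h3 hRpos
        exact le_of_mul_le_mul_left h4 hnj
      · have h5 : ((n : ℝ) - j - 1) * (n * k (j + 2)) ≤ ((n : ℝ) - j - 1) * (m * k (j + 1)) := by
          have e : ((n : ℝ) - j - 1) * (n * k (j + 2)) = n * (m * k (j + 1) - (j + 1) * k j) := by
            rw [← hr]; ring
          rw [e]
          have h6 : m * k (j + 1) ≤ n * k j := by
            have : m * (n * k (j + 1)) ≤ n * (n * k j) := by nlinarith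
            nlinarith
          nlinarith
        exact le_of_mul_le_mul_left h5 hnj
  cases i with
  | zero => simp [h0]
  | succ j =>
    obtain ⟨hp, hle, hlo, hhi⟩ := step j (by omega)
    refine ⟨lt_of_lt_of_le (by positivity) hlo, ?_⟩
    rw [pow_succ]
    have : k (j + 1) ≤ k j * (m / n) := by
      rw [mul_div_assoc', le_div_iff₀ hnR]; linarith
    exact this.trans (by gcongr)

/-- Stirling's lower bound for a binomial coefficient, in logarithmic form. -/
lemma le_log_choose {n k : ℕ} (hk : 0 < k) (hkn : k < n) :
    n * Real.log n - k * Real.log k - (n - k) * Real.log (n - k)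
      + (Real.log n - Real.log k - Real.log (n - k)) / 2 + (Real.log (2 * Real.pi) / 2 - 2)
      ≤ Real.log (n.choose k) := by
  obtain ⟨l, rfl⟩ := Nat.exists_eq_add_of_le hkn.le
  have hl : 0 < l := by omega
  have hfac : ∀ a : ℕ, 0 < a → Real.log (a.factorial)
      = Real.log (Stirling.stirlingSeq a) + (Real.log 2 + Real.log a) / 2
        + a * (Real.log a - 1) := by
    intro a ha
    have haR : (a : ℝ) ≠ 0 := by positivity
    have := Stirling.log_stirlingSeq_formula a
    rw [Real.log_mul (by norm_num) haR, Real.log_div haR (Real.exp_pos 1).ne', Real.log_exp] at this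
    linarith
  have hub : ∀ a : ℕ, 0 < a → Real.log (Stirling.stirlingSeq a) ≤ 1 - Real.log 2 / 2 := by
    intro a ha
    obtain ⟨b, rfl⟩ : ∃ b, a = b + 1 := ⟨a - 1, by omega⟩
    have h := Stirling.log_stirlingSeq'_antitone (Nat.zero_le b)
    simp only [Function.comp_apply, Nat.succ_eq_add_one, Stirling.stirlingSeq_one, zero_add] at h
    rw [Real.log_div (Real.exp_pos 1).ne' (by positivity), Real.log_exp,
      Real.log_sqrt (by norm_num)] at h
    exact h
  have hlb : Real.log Real.pi / 2 ≤ Real.log (Stirling.stirlingSeq (k + l)) := by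
    rw [← Real.log_sqrt Real.pi_pos.le]
    exact Real.log_le_log (by positivity) (Stirling.sqrt_pi_le_stirlingSeq (by omega))
  have hch : Real.log ((k + l).factorial)
      = Real.log ((k + l).choose k) + Real.log (k.factorial) + Real.log (l.factorial) := by
    have h := Nat.choose_mul_factorial_mul_factorial hkn.le
    rw [Nat.add_sub_cancel_left] at h
    have hc : ((k + l).choose k : ℝ) ≠ 0 := by
      exact_mod_cast (Nat.choose_pos (Nat.le_add_right k l)).ne'
    rw [← h]
    push_cast
    rw [Real.log_mul (by positivity) (by positivity), Real.log_mul hc (by positivity)]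
  rw [hfac _ (by omega), hfac k hk, hfac l hl] at hch
  have h1 := hub k hk
  have h2 := hub l hl
  have hpi : Real.log (2 * Real.pi) = Real.log 2 + Real.log Real.pi :=
    Real.log_mul (by norm_num) Real.pi_pos.ne'
  have e : ((k + l : ℕ) : ℝ) - k = l := by push_cast; ring
  rw [e, hpi]
  have e2 : ((k + l : ℕ) : ℝ) = k + l := by push_cast; ring
  rw [e2] at hch ⊢
  linarith

/-- A polynomial bound for the entropy deficit `log 2 - H((1 - x) / 2)`. -/
lemma entropy_deficit_le {x : ℝ} (h0 : 0 ≤ x) (h1 : x ≤ 37 / 50) :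
    ((1 - x) * Real.log (1 - x) + (1 + x) * Real.log (1 + x)) / 2
      ≤ x ^ 2 / 2 + x ^ 4 / 12 + x ^ 6 / 13 := by
  -- the difference and its first derivative both vanish at `0` and are monotone
  have hd1 : ∀ y ∈ Set.Icc (0 : ℝ) (37 / 50),
      (Real.log (1 + y) - Real.log (1 - y)) / 2 ≤ y + y ^ 3 / 3 + 6 * y ^ 5 / 13 := by
    have hder : ∀ z ∈ Set.Icc (0 : ℝ) (37 / 50), HasDerivAt
        (fun y : ℝ => y + y ^ 3 / 3 + 6 * y ^ 5 / 13 - (Real.log (1 + y) - Real.log (1 - y)) / 2)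
        (1 + z ^ 2 + 30 * z ^ 4 / 13 - (1 / (1 + z) - (-1) / (1 - z)) / 2) z := by
      intro z hz
      have n1 : 1 + z ≠ 0 := by linarith [hz.1]
      have n2 : 1 - z ≠ 0 := by linarith [hz.2]
      have ha := ((hasDerivAt_id z).const_add 1).log n1
      have hb := ((hasDerivAt_id z).const_sub 1).log n2
      have hp := ((hasDerivAt_id z).add ((hasDerivAt_pow 3 z).div_const 3)).add
        (((hasDerivAt_pow 5 z).const_mul 6).div_const 13)
      refine (hp.sub ((ha.sub hb).div_const 2)).congr_deriv ?_
      simp only [id]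
      push_cast
      ring
    have hmono : MonotoneOn (fun y : ℝ => y + y ^ 3 / 3 + 6 * y ^ 5 / 13
        - (Real.log (1 + y) - Real.log (1 - y)) / 2) (Set.Icc 0 (37 / 50)) := by
      refine monotoneOn_of_hasDerivWithinAt_nonneg (convex_Icc _ _)
        (fun z hz => (hder z hz).continuousAt.continuousWithinAt)
        (fun z hz => (hder z (interior_subset hz)).hasDerivWithinAt) (fun z hz => ?_)
      have hz := interior_subset hz
      have p1 : 0 < 1 + z := by linarith [hz.1]
      have p2 : 0 < 1 - z := by linarith [hz.2]
      have e : 1 + z ^ 2 + 30 * z ^ 4 / 13 - (1 / (1 + z) - (-1) / (1 - z)) / 2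
          = z ^ 4 * (17 / 13 - 30 / 13 * z ^ 2) / ((1 + z) * (1 - z)) := by
        field_simp; ring
      rw [e]
      have : 0 ≤ 17 / 13 - 30 / 13 * z ^ 2 := by nlinarith [hz.1, hz.2]
      positivity
    intro y hy
    have := hmono (Set.left_mem_Icc.2 (by norm_num)) hy hy.1
    simp at this
    linarith
  have hder : ∀ z ∈ Set.Icc (0 : ℝ) (37 / 50), HasDerivAt
      (fun y : ℝ => y ^ 2 / 2 + y ^ 4 / 12 + y ^ 6 / 13
        - ((1 - y) * Real.log (1 - y) + (1 + y) * Real.log (1 + y)) / 2)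
      (z + z ^ 3 / 3 + 6 * z ^ 5 / 13 - (Real.log (1 + z) - Real.log (1 - z)) / 2) z := by
    intro z hz
    have n1 : 1 + z ≠ 0 := by linarith [hz.1]
    have n2 : 1 - z ≠ 0 := by linarith [hz.2]
    have ha := ((hasDerivAt_id z).const_add 1).mul (((hasDerivAt_id z).const_add 1).log n1)
    have hb := ((hasDerivAt_id z).const_sub 1).mul (((hasDerivAt_id z).const_sub 1).log n2)
    have hp := (((hasDerivAt_pow 2 z).div_const 2).add ((hasDerivAt_pow 4 z).div_const 12)).add
        ((hasDerivAt_pow 6 z).div_const 13)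
    refine (hp.sub ((hb.add ha).div_const 2)).congr_deriv ?_
    simp only [id]
    push_cast
    field_simp
    ring
  have hmono : MonotoneOn (fun y : ℝ => y ^ 2 / 2 + y ^ 4 / 12 + y ^ 6 / 13
        - ((1 - y) * Real.log (1 - y) + (1 + y) * Real.log (1 + y)) / 2)
        (Set.Icc 0 (37 / 50)) := by
    refine monotoneOn_of_hasDerivWithinAt_nonneg (convex_Icc _ _)
      (fun z hz => (hder z hz).continuousAt.continuousWithinAt)
      (fun z hz => (hder z (interior_subset hz)).hasDerivWithinAt) (fun z hz => ?_)
    have := hd1 z (interior_subset hz)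
    linarith
  have := hmono (Set.left_mem_Icc.2 (by norm_num)) ⟨h0, h1⟩ h0
  simp at this
  linarith

lemma log_one_sub_two_mul_ge {ω : ℝ} (h0 : 0 ≤ ω) (h1 : ω ≤ 4 / 25) :
    -(2 * ω + 2 * ω ^ 2 + 18 / 5 * ω ^ 3) ≤ Real.log (1 - 2 * ω) := by
  have habs : |2 * ω| < 1 := by rw [abs_of_nonneg (by positivity)]; linarith
  have h := (abs_le.1 (Real.abs_log_sub_add_sum_range_le habs 7)).1
  rw [abs_of_nonneg (by positivity : 0 ≤ 2 * ω)] at h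
  norm_num [Finset.sum_range_succ] at h
  have h2 : (2 * ω) ^ 8 / (1 - 2 * ω) ≤ 400 * ω ^ 8 := by
    rw [div_le_iff₀ (by linarith)]
    nlinarith [pow_nonneg h0 8, mul_nonneg (pow_nonneg h0 8) (sub_nonneg.2 h1)]
  have hp : ∀ k : ℕ, ω ^ (k + 3) ≤ (4 / 25) ^ k * ω ^ 3 := fun k => by
    rw [pow_add]; gcongr
  have h4 := hp 1
  have h5 := hp 2
  have h6 := hp 3
  have h7 := hp 4
  have h8 := hp 5
  norm_num at h4 h5 h6 h7 h8
  nlinarith [pow_nonneg h0 3]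

lemma log_one_sub_le {ω : ℝ} (h0 : 0 ≤ ω) (h1 : ω < 1) :
    Real.log (1 - ω) ≤ -(ω + ω ^ 2 / 2) := by
  have habs : |ω| < 1 := by rwa [abs_of_nonneg h0]
  have h := sum_le_hasSum (Finset.range 2) (fun i _ => by positivity)
    (Real.hasSum_pow_div_log_of_abs_lt_one habs)
  norm_num [Finset.sum_range_succ] at h
  linarith

lemma turning_point_slope_nonneg {v : ℝ} (h0 : 0 ≤ v) (h1 : v ≤ 2 / 5) :
    2 * v ^ 2 + 2 * v ^ 4 + 18 / 5 * v ^ 6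
      ≤ (2 * v - v ^ 3) / 2 + (2 * v - v ^ 3) ^ 3 / 12 + (2 * v - v ^ 3) ^ 5 / 13 := by
  have e : 2 * v - v ^ 3 = 2 * v * (1 - v ^ 2 / 2) := by ring
  have hT : 46 / 25 * v ≤ 2 * v - v ^ 3 := by nlinarith
  have h5 : (46 / 25 * v) ^ 5 ≤ (2 * v - v ^ 3) ^ 5 := by gcongr
  have key : 0 ≤ v * (1 - 2 * v + (-1 / 2 + (46 / 25) ^ 3 / 12) * v ^ 2 - 2 * v ^ 3
      + (46 / 25) ^ 5 / 13 * v ^ 4 - 18 / 5 * v ^ 5) := by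
    refine mul_nonneg h0 ?_
    have p2 : v ^ 2 ≤ 2 / 5 * v := by nlinarith
    nlinarith
  nlinarith

lemma entropy_exponent_poly_le {v : ℝ} (h0 : 0 ≤ v) (h1 : v ≤ 2 / 5) :
    (1 - (2 * v - v ^ 3)) * (2 * v ^ 2 + 2 * v ^ 4 + 18 / 5 * v ^ 6)
      + ((2 * v - v ^ 3) ^ 2 / 2 + (2 * v - v ^ 3) ^ 4 / 12 + (2 * v - v ^ 3) ^ 6 / 13)
      ≤ (1 - v ^ 2) * (v ^ 2 + v ^ 4 / 2) + v ^ 2 * (3 - 33 / 10 * v) := by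
  have q1 : 0 ≤ 0.7 - (11 / 6) * v + 2 * v ^ 2 - (2674 / 390) * v ^ 3 + (26 / 5) * v ^ 4
      + 8 * v ^ 5 := by
    obtain ⟨u, rfl⟩ : ∃ u, v = 2 / 5 - u := ⟨2 / 5 - v, by ring⟩
    have hu : 0 ≤ u := by linarith
    ring_nf
    nlinarith [pow_nonneg hu 2, pow_nonneg hu 3, pow_nonneg hu 4]
  have q2 : 0 ≤ v ^ 5 * (166 / 13 - 8 - 18 / 5 * v - 1388 / 78 * v ^ 2) :=
    mul_nonneg (by positivity) (by nlinarith)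
  have q3 : 0 ≤ v ^ 9 * (12.2 - 4.7 * v ^ 2) := mul_nonneg (by positivity) (by nlinarith)
  have q4 : 0 ≤ v ^ 13 * (0.9 - 0.1 * v ^ 2) := mul_nonneg (by positivity) (by nlinarith)
  have hv3 : 0 ≤ v ^ 3 := by positivity
  have := pow_nonneg h0 12
  have := pow_nonneg h0 14
  have := pow_nonneg h0 16
  have := pow_nonneg h0 18
  have := pow_nonneg h0 10
  ring_nf at *
  nlinarith

/-- The exponential rate of `C(n, w) C(n, i) (1 - 2 w / n) ^ (2 i) / 2 ^ n`, bounded below in the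
oscillatory region, with `w / n = v ^ 2` and `i / n = (1 - x) / 2`. -/
lemma exponent_ge {v x : ℝ} (hv : 0 < v) (hv1 : v ≤ 2 / 5) (hx : 0 ≤ x)
    (hxv : x ^ 2 ≤ 4 * v ^ 2 * (1 - v ^ 2)) :
    v ^ 2 * (-2 * Real.log v - 3 + 33 / 10 * v) ≤
      v ^ 2 * (-2 * Real.log v) - (1 - v ^ 2) * Real.log (1 - v ^ 2)
        - ((1 - x) * Real.log (1 - x) + (1 + x) * Real.log (1 + x)) / 2
        + (1 - x) * Real.log (1 - 2 * v ^ 2) := by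
  obtain ⟨T, hT⟩ : ∃ T, T = 2 * v - v ^ 3 := ⟨_, rfl⟩
  have hv2 : v ^ 2 ≤ 4 / 25 := by nlinarith
  have hT0 : 0 ≤ T := by rw [hT]; nlinarith
  have hT1 : T ≤ 37 / 50 := by
    rw [hT]
    nlinarith [mul_nonneg (sub_nonneg.2 hv1) (by nlinarith : 0 ≤ 42 / 25 - v * (v + 2 / 5))]
  have hxT : x ≤ T := by
    have : T ^ 2 = 4 * v ^ 2 * (1 - v ^ 2) + v ^ 6 := by rw [hT]; ring
    exact pow_le_pow_iff_left₀ hx hT0 two_ne_zero |>.1 (by linarith [pow_pos hv 6])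
  have hE := entropy_deficit_le hx (hxT.trans hT1)
  have hA := log_one_sub_two_mul_ge (sq_nonneg v) hv2
  have hB := log_one_sub_le (sq_nonneg v) (by linarith)
  have hS := turning_point_slope_nonneg hv.le hv1
  have hQ := entropy_exponent_poly_le hv.le hv1
  rw [← hT] at hS hQ
  obtain ⟨r, hr⟩ : ∃ r, r = 2 * v ^ 2 + 2 * v ^ 4 + 18 / 5 * v ^ 6 := ⟨_, rfl⟩
  have hA : -r ≤ Real.log (1 - 2 * v ^ 2) := by
    refine le_trans (le_of_eq ?_) hA
    rw [hr]; ring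
  rw [← hr] at hS hQ
  have hconv : x ^ 2 / 2 + x ^ 4 / 12 + x ^ 6 / 13 - x * r
      ≤ T ^ 2 / 2 + T ^ 4 / 12 + T ^ 6 / 13 - T * r := by
    have b2 : x * (x / 2 + x ^ 3 / 12 + x ^ 5 / 13 - r)
        ≤ x * (T / 2 + T ^ 3 / 12 + T ^ 5 / 13 - r) := by gcongr
    have b3 : x * (T / 2 + T ^ 3 / 12 + T ^ 5 / 13 - r)
        ≤ T * (T / 2 + T ^ 3 / 12 + T ^ 5 / 13 - r) :=
      mul_le_mul_of_nonneg_right hxT (by linarith)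
    linarith
  have hA' : (1 - x) * (-r) ≤ (1 - x) * Real.log (1 - 2 * v ^ 2) :=
    mul_le_mul_of_nonneg_left hA (by linarith)
  have hB' : (1 - v ^ 2) * Real.log (1 - v ^ 2) ≤ (1 - v ^ 2) * (-(v ^ 2 + (v ^ 2) ^ 2 / 2)) :=
    mul_le_mul_of_nonneg_left hB (by linarith)
  nlinarith

/-- The exponential gain in the oscillatory region dominates the polynomial loss. -/
lemma log_add_le_exponent {w v : ℝ} (hw : 3 ≤ w) (hv : 0 < v) (hv1 : v ≤ 2 / 5)
    (hvw : 300 * v ^ 2 ≤ w) :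
    Real.log w + 151 / 100 - Real.log v ≤ w * (-2 * Real.log v - 3 + 33 / 10 * v) := by
  have he1 := Real.exp_one_lt_d9
  have he0 := Real.exp_one_gt_d9
  have l2 := Real.log_two_lt_d9
  -- tangent lines of the logarithm at `exp (-1)` and `exp (-2)`
  have t1 : Real.log v ≤ Real.exp 1 * v - 2 := by
    have h := Real.log_le_sub_one_of_pos (mul_pos (Real.exp_pos 1) hv)
    rw [Real.log_mul (Real.exp_pos 1).ne' hv.ne', Real.log_exp] at h
    linarith
  have t2 : Real.log v ≤ Real.exp 1 ^ 2 * v - 3 := by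
    have h := Real.log_le_sub_one_of_pos (mul_pos (pow_pos (Real.exp_pos 1) 2) hv)
    rw [Real.log_mul (by positivity) hv.ne', Real.log_pow, Real.log_exp] at h
    push_cast at h
    linarith
  have t1' : Real.log v ≤ 2.7183 * v - 2 := by nlinarith
  have t2' : Real.log v ≤ 7.39 * v - 3 := by
    have : Real.exp 1 ^ 2 ≤ 7.39 := by nlinarith
    nlinarith
  have hwpos : 0 < w := by linarith
  have htan : ∀ c : ℝ, 0 < c → Real.log w ≤ Real.log c + (w / c - 1) := by
    intro c hc
    have h := Real.log_le_sub_one_of_pos (div_pos hwpos hc)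
    rw [Real.log_div hwpos.ne' hc.ne'] at h
    linarith
  rcases le_total v (1 / 10) with h | h
  · have h3 : Real.log 3 ≤ 1.15 := by
      have := Real.log_le_sub_one_of_pos (show (0 : ℝ) < 3 / 4 by norm_num)
      rw [Real.log_div (by norm_num) (by norm_num), show (4 : ℝ) = 2 ^ 2 by norm_num,
        Real.log_pow] at this
      push_cast at this
      linarith
    have := htan 3 (by norm_num)
    nlinarith
  · obtain ⟨c, hc⟩ : ∃ c, c = 300 * v ^ 2 := ⟨_, rfl⟩
    have hc3 : 3 ≤ c := by rw [hc]; nlinarith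
    have hcpos : 0 < c := by linarith
    have hlc : Real.log c ≤ 5.72 + 2 * Real.log v := by
      rw [hc, Real.log_mul (by norm_num) (by positivity), Real.log_pow]
      have := Real.log_le_sub_one_of_pos (show (0 : ℝ) < 300 / 256 by norm_num)
      rw [Real.log_div (by norm_num) (by norm_num), show (256 : ℝ) = 2 ^ 8 by norm_num,
        Real.log_pow] at this
      push_cast at this ⊢
      linarith
    have hw' : w / c - 1 = (w - c) * (1 / c) := by field_simp
    have h1 := htan c hcpos
    rw [hw'] at h1
    rw [← hc] at hvw
    -- the claim is affine in `w` after the tangent bound, with nonnegative slope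
    suffices hs : 1 / c ≤ -2 * Real.log v - 3 + 33 / 10 * v ∧
        7.23 + Real.log v ≤ c * (-2 * Real.log v - 3 + 33 / 10 * v) by
      have := mul_le_mul_of_nonneg_left hs.1 (sub_nonneg.2 hvw)
      nlinarith
    rcases le_total v (1 / 5) with h5 | h5
    · constructor
      · have : 1 / c ≤ 1 / 3 := by gcongr
        linarith
      · have hl := mul_le_mul_of_nonneg_left t2' (by linarith : 0 ≤ 2 * c + 1)
        have hp : 0 ≤ 3 * c - 11.48 * (c * v) - 4.23 - 7.39 * v := by
          rw [hc]
          nlinarith [mul_nonneg (sub_nonneg.2 h) (sub_nonneg.2 h5),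
            mul_nonneg (mul_nonneg (sub_nonneg.2 h) (sub_nonneg.2 h5)) hv.le]
        nlinarith
    · constructor
      · have : 1 / c ≤ 1 / 12 := by
          gcongr
          rw [hc]; nlinarith
        linarith
      · have hl := mul_le_mul_of_nonneg_left t1' (by linarith : 0 ≤ 2 * c + 1)
        have hp : 0 ≤ c - 2.1366 * (c * v) - 5.23 - 2.7183 * v := by
          rw [hc]
          nlinarith [mul_nonneg (sub_nonneg.2 h5) (sub_nonneg.2 hv1),
            mul_nonneg (mul_nonneg (sub_nonneg.2 h5) (sub_nonneg.2 hv1)) hv.le]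
        nlinarith

lemma abs_kraw_le_of_turning_point {n w i : ℕ} (hw : 2 * w < n) (hi : 2 * i ≤ n)
    (hdisc : 4 * (i : ℝ) * (n - i) ≤ ((n : ℝ) - 2 * w) ^ 2) :
    |Kraw n w i| ≤ (n.choose w : ℝ) * (1 - 2 * w / n) ^ i := by
  have hnR : (0 : ℝ) < n := by exact_mod_cast (by omega : 0 < n)
  have hwR : 2 * (w : ℝ) < n := by exact_mod_cast hw
  have hcp : ∀ {j : ℕ}, j ≤ n → (0 : ℝ) < n.choose j := fun hj => by
    exact_mod_cast Nat.choose_pos hj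
  have hsucc : ∀ {j : ℕ}, j ≤ n →
      (n.choose (j + 1) : ℝ) * (j + 1) = n.choose j * (n - j) := fun {j} hj => by
    have := Nat.choose_succ_right_eq n j
    rw [← Nat.cast_sub hj]
    exact_mod_cast this
  obtain ⟨hpos, hle⟩ := recurrence_pos_le_pow (n := n) (i := i) (m := n - 2 * w)
    (k := fun j => Kraw n j w / n.choose j) (by omega) (by linarith)
    (by linarith [Nat.cast_nonneg (α := ℝ) w]) hi hdisc (by simp [kraw_zero])
    (by simp only [kraw_one (by omega : w ≤ n), Nat.choose_one_right]; field_simp)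
    (fun j hj => by
      have hr := kraw_recurrence (by omega : w ≤ n) j
      have h1 := hsucc (by omega : j ≤ n)
      have h2 := hsucc (by omega : j + 1 ≤ n)
      have c0 := (hcp (by omega : j ≤ n)).ne'
      have c1 := (hcp (by omega : j + 1 ≤ n)).ne'
      have c2 := (hcp (by omega : j + 2 ≤ n)).ne'
      push_cast at h2
      have e2 : ((n : ℝ) - j - 1) * (Kraw n (j + 2) w / n.choose (j + 2))
          = (j + 2) * Kraw n (j + 2) w / n.choose (j + 1) := by
        rw [mul_div_assoc', div_eq_div_iff c2 c1]
        linear_combination (-Kraw n (j + 2) w) * h2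
      have e0 : ((j : ℝ) + 1) * (Kraw n j w / n.choose j)
          = (n - j) * Kraw n j w / n.choose (j + 1) := by
        rw [mul_div_assoc', div_eq_div_iff c0 c1]
        linear_combination (Kraw n j w) * h1
      rw [e2, e0, hr]
      ring)
  have hci := hcp (by omega : i ≤ n)
  have e : Kraw n w i = n.choose w * (Kraw n i w / n.choose i) := by
    rw [mul_div_assoc', eq_div_iff hci.ne', mul_comm]
    exact choose_mul_kraw_comm (by omega) (by omega)
  have hρ : 1 - 2 * (w : ℝ) / n = (n - 2 * w) / n := by field_simp
  rw [e, abs_of_nonneg (by positivity), hρ]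
  gcongr

/-- The bound of `choose_mul_kraw_sq_le` suffices when the binomials are large enough. -/
lemma abs_kraw_le_of_log_choose {n w i : ℕ} (hw : 2 * w < n) (hi : i ≤ n)
    (h : n * Real.log 2 ≤ Real.log (n.choose w) + Real.log (n.choose i)
      + 2 * i * Real.log (1 - 2 * w / n)) :
    |Kraw n w i| ≤ (n.choose w : ℝ) * (1 - 2 * w / n) ^ i := by
  have hnR : (0 : ℝ) < n := by exact_mod_cast (by omega : 0 < n)
  have hwR : 2 * (w : ℝ) < n := by exact_mod_cast hw
  have hcw : (0 : ℝ) < n.choose w := by exact_mod_cast Nat.choose_pos (by omega : w ≤ n)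
  have hci : (0 : ℝ) < n.choose i := by exact_mod_cast Nat.choose_pos hi
  have hρ : 0 < 1 - 2 * (w : ℝ) / n := by rw [sub_pos, div_lt_one hnR]; exact hwR
  have h2 : (2 : ℝ) ^ n ≤ n.choose w * n.choose i * (1 - 2 * w / n) ^ (2 * i) := by
    rw [← Real.log_le_log_iff (by positivity) (by positivity), Real.log_pow,
      Real.log_mul (by positivity) (by positivity), Real.log_mul hcw.ne' hci.ne', Real.log_pow]
    push_cast
    exact h
  have h3 := choose_mul_kraw_sq_le (by omega : w ≤ n) hi
  refine abs_le_of_sq_le_sq ?_ (by positivity)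
  refine le_of_mul_le_mul_left (h3.trans ?_) hci
  calc (2 : ℝ) ^ n * n.choose w
      ≤ n.choose w * n.choose i * (1 - 2 * w / n) ^ (2 * i) * n.choose w := by gcongr
    _ = _ := by ring

lemma log_two_pi_ge : (1.8 : ℝ) ≤ Real.log (2 * Real.pi) := by
  have h := Real.one_sub_inv_le_log_of_pos (show (0 : ℝ) < 0.785 by norm_num)
  have e : Real.log 6.28 = 3 * Real.log 2 + Real.log 0.785 := by
    rw [show (6.28 : ℝ) = 2 ^ 3 * 0.785 by norm_num, Real.log_mul (by norm_num) (by norm_num),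
      Real.log_pow]
    norm_num
  have hle : Real.log 6.28 ≤ Real.log (2 * Real.pi) :=
    Real.log_le_log (by norm_num) (by linarith [Real.pi_gt_d2])
  have l2 := Real.log_two_gt_d9
  norm_num at h l2 ⊢
  linarith

/-- The logarithmic estimate needed in `abs_kraw_le_of_log_choose`, in the coordinates
`w / n = v ^ 2` and `i / n = (1 - x) / 2`. -/
lemma log_choose_add_log_choose_ge {n w i : ℕ} {v x : ℝ} (hn : 300 ≤ n) (hw3 : 3 ≤ w) (hwn : w < n)
    (hi0 : 0 < i) (hin : i < n) (hv0 : 0 < v) (hv1 : v ≤ 2 / 5) (hx0 : 0 ≤ x) (hx1 : x < 1)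
    (hwv : (w : ℝ) = n * v ^ 2) (hix : (i : ℝ) = n * ((1 - x) / 2))
    (hxv : x ^ 2 ≤ 4 * v ^ 2 * (1 - v ^ 2)) :
    n * Real.log 2 ≤ Real.log (n.choose w) + Real.log (n.choose i)
      + 2 * i * Real.log (1 - 2 * v ^ 2) := by
  have hnR : (300 : ℝ) ≤ n := by exact_mod_cast hn
  have hn0 : (0 : ℝ) < n := by linarith
  have hw3R : (3 : ℝ) ≤ w := by exact_mod_cast hw3
  have hv2lt : v ^ 2 < 1 := by nlinarith
  have hcw := le_log_choose (by omega : 0 < w) hwn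
  have hci := le_log_choose hi0 hin
  have hE := mul_le_mul_of_nonneg_left (exponent_ge hv0 hv1 hx0 hxv) hn0.le
  have hF := log_add_le_exponent hw3R hv0 hv1
    (by rw [hwv]; exact mul_le_mul_of_nonneg_right hnR (sq_nonneg v))
  have lw : Real.log w = Real.log n + 2 * Real.log v := by
    rw [hwv, Real.log_mul hn0.ne' (by positivity), Real.log_pow, Nat.cast_ofNat]
  have lnw : Real.log (n - w) = Real.log n + Real.log (1 - v ^ 2) := by
    rw [hwv, ← Real.log_mul hn0.ne' (by linarith), mul_sub, mul_one]
  have li : Real.log i = Real.log n + (Real.log (1 - x) - Real.log 2) := by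
    rw [hix, Real.log_mul hn0.ne' (by linarith), Real.log_div (by linarith) (by norm_num)]
  have lni : Real.log (n - i) = Real.log n + (Real.log (1 + x) - Real.log 2) := by
    rw [hix, ← Real.log_div (by linarith) (by norm_num), ← Real.log_mul hn0.ne' (by linarith)]
    congr 1
    ring
  have hs : Real.log (1 - v ^ 2) ≤ 0 :=
    Real.log_nonpos (by linarith) (by linarith [sq_nonneg v])
  have hs' : Real.log (1 - x) + Real.log (1 + x) ≤ 0 := by
    rw [← Real.log_mul (by linarith) (by linarith)]
    exact Real.log_nonpos (mul_nonneg (by linarith) (by linarith)) (by linarith [sq_nonneg x])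
  have hpi := log_two_pi_ge
  have l2 := Real.log_two_gt_d9
  rw [lw, lnw, hwv] at hcw
  rw [li, lni, hix] at hci
  rw [lw, hwv] at hF
  rw [hix]
  linear_combination hcw + hci + hE + hF + hs / 2 + hs' / 2 + hpi + l2

lemma kraw_universal_bound_of_three_le {n w i : ℕ} (hn : 300 ≤ n) (hw3 : 3 ≤ w)
    (hw : (w : ℝ) ≤ 0.16 * n) (hi : 2 * i ≤ n) (hwn : 2 * w < n) :
    |Kraw n w i| ≤ (n.choose w : ℝ) * (1 - 2 * w / n) ^ i := by
  rcases le_or_gt (4 * (i : ℝ) * (n - i)) (((n : ℝ) - 2 * w) ^ 2) with hd | hd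
  · exact abs_kraw_le_of_turning_point hwn hi hd
  have hi0 : 0 < i := by
    rcases Nat.eq_zero_or_pos i with rfl | h
    · simp only [Nat.cast_zero, mul_zero, zero_mul] at hd
      linarith [sq_nonneg ((n : ℝ) - 2 * w)]
    · exact h
  have hn0 : (0 : ℝ) < n := by exact_mod_cast (by omega : 0 < n)
  have hiR : 2 * (i : ℝ) ≤ n := by exact_mod_cast hi
  have hi0R : (0 : ℝ) < i := by exact_mod_cast hi0
  refine abs_kraw_le_of_log_choose hwn (by omega) ?_
  obtain ⟨v, hv⟩ : ∃ v, v = √((w : ℝ) / n) := ⟨_, rfl⟩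
  obtain ⟨x, hx⟩ : ∃ x, x = ((n : ℝ) - 2 * i) / n := ⟨_, rfl⟩
  have hv0 : 0 < v := by rw [hv]; positivity
  have hv2 : v ^ 2 = w / n := by rw [hv, Real.sq_sqrt (by positivity)]
  have hwv : (w : ℝ) = n * v ^ 2 := by rw [hv2]; field_simp
  have hv1 : v ≤ 2 / 5 := by
    have : v ^ 2 ≤ (2 / 5) ^ 2 := by
      rw [hv2, div_le_iff₀ hn0]; linarith
    exact (pow_le_pow_iff_left₀ hv0.le (by norm_num) two_ne_zero).1 this
  have hix : (i : ℝ) = n * ((1 - x) / 2) := by rw [hx]; field_simp; ring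
  have hx0 : 0 ≤ x := by rw [hx]; exact div_nonneg (by linarith) hn0.le
  have hx1 : x < 1 := by rw [hx, div_lt_one hn0]; linarith
  have hxv : x ^ 2 ≤ 4 * v ^ 2 * (1 - v ^ 2) := by
    rw [hwv, hix] at hd
    have : (n : ℝ) ^ 2 * x ^ 2 ≤ n ^ 2 * (4 * v ^ 2 * (1 - v ^ 2)) := by linear_combination hd
    exact le_of_mul_le_mul_left this (by positivity)
  have hρ : 1 - 2 * (w : ℝ) / n = 1 - 2 * v ^ 2 := by rw [hv2]; ring
  rw [hρ]
  exact log_choose_add_log_choose_ge hn hw3 (by omega) hi0 (by omega) hv0 hv1 hx0 hx1 hwv hix hxv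

lemma kraw_universal_bound_of_one {n i : ℕ} (hn : 300 ≤ n) (hi : 2 * i ≤ n) :
    |Kraw n 1 i| ≤ (n.choose 1 : ℝ) * (1 - 2 * (1 : ℕ) / n) ^ i := by
  have hnR : (300 : ℝ) ≤ n := by exact_mod_cast hn
  have hiR : 2 * (i : ℝ) ≤ n := by exact_mod_cast hi
  have h2n : 2 / (n : ℝ) ≤ 2 / 300 := by gcongr
  have hb := one_add_mul_le_pow (show (-2 : ℝ) ≤ -(2 / n) by linarith) i
  have hm := mul_le_mul_of_nonneg_left hb (by linarith : (0 : ℝ) ≤ n)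
  rw [kraw_one (by omega), abs_of_nonneg (by linarith), Nat.choose_one_right, Nat.cast_one, mul_one,
    sub_eq_add_neg 1]
  refine le_trans (le_of_eq ?_) hm
  field_simp
  ring

lemma kraw_two {n i : ℕ} (hi : i ≤ n) : Kraw n 2 i = (((n : ℝ) - 2 * i) ^ 2 - n) / 2 := by
  have h := kraw_recurrence hi 0
  rw [kraw_zero, zero_add, zero_add, kraw_one hi] at h
  push_cast at h
  linarith

lemma kraw_universal_bound_of_two {n i : ℕ} (hn : 300 ≤ n) (hi : 2 * i ≤ n) :
    |Kraw n 2 i| ≤ (n.choose 2 : ℝ) * (1 - 2 * (2 : ℕ) / n) ^ i := by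
  rcases le_or_gt (4 * (i : ℝ) * (n - i)) (((n : ℝ) - 2 * (2 : ℕ)) ^ 2) with hd | hd
  · exact abs_kraw_le_of_turning_point (by omega) hi hd
  have hnR : (300 : ℝ) ≤ n := by exact_mod_cast hn
  have hn0 : (0 : ℝ) < n := by linarith
  have hiR : 2 * (i : ℝ) ≤ n := by exact_mod_cast hi
  push_cast at hd ⊢
  have habs : |Kraw n 2 i| ≤ 7 / 2 * n := by
    rw [kraw_two (by omega), abs_le]
    constructor <;> nlinarith [sq_nonneg ((n : ℝ) - 2 * i)]
  have hρ : (0 : ℝ) < 1 - 2 * 2 / n := by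
    rw [sub_pos, div_lt_one hn0]; linarith
  have hpow : (1 / 27 : ℝ) ≤ (1 - 2 * 2 / n) ^ i := by
    have hl : -3 ≤ i * Real.log (1 - 2 * 2 / n) := by
      have h := Real.one_sub_inv_le_log_of_pos hρ
      have e : 1 - (1 - 2 * 2 / (n : ℝ))⁻¹ = -(4 / (n - 4)) := by
        have : (n : ℝ) - 4 ≠ 0 := by linarith
        have h3 : (1 - 2 * 2 / (n : ℝ)) = (n - 4) / n := by field_simp; norm_num
        rw [h3, inv_div]
        field_simp
        ring
      rw [e] at h
      have h4 : i * (4 / ((n : ℝ) - 4)) ≤ 3 := by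
        rw [mul_div_assoc', div_le_iff₀ (by linarith)]; linarith
      have := mul_le_mul_of_nonneg_left h (Nat.cast_nonneg (α := ℝ) i)
      linarith
    rw [← Real.log_le_log_iff (by norm_num) (by positivity), Real.log_pow]
    refine le_trans ?_ hl
    have h3 : 1 ≤ Real.log 3 := by
      rw [Real.le_log_iff_exp_le (by norm_num)]
      linarith [Real.exp_one_lt_d9]
    rw [show (1 / 27 : ℝ) = (3 ^ 3)⁻¹ by norm_num, Real.log_inv, Real.log_pow]
    push_cast
    linarith
  have hch : (n.choose 2 : ℝ) = n * (n - 1) / 2 := Nat.cast_choose_two ℝ n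
  calc |Kraw n 2 i| ≤ 7 / 2 * n := habs
    _ ≤ n.choose 2 * (1 / 27) := by rw [hch]; nlinarith
    _ ≤ _ := by gcongr

theorem kraw_universal_bound (n w i : ℕ) (hn : 300 ≤ n)
    (hw : (w : ℝ) ≤ 0.16 * n) (hi : (i : ℝ) ≤ (n : ℝ) / 2) :
    |Kraw n w i| ≤ (n.choose w : ℝ) * (1 - 2 * w / n) ^ i := by
  have hn0 : (300 : ℝ) ≤ n := by exact_mod_cast hn
  have hi' : 2 * i ≤ n := by
    have : 2 * (i : ℝ) ≤ n := by linarith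
    exact_mod_cast this
  have hwn : 2 * w < n := by
    have : 2 * (w : ℝ) < n := by linarith
    exact_mod_cast this
  rcases (by omega : w = 0 ∨ w = 1 ∨ w = 2 ∨ 3 ≤ w) with rfl | rfl | rfl | hw3
  · simp [kraw_zero]
  · exact kraw_universal_bound_of_one hn hi'
  · exact kraw_universal_bound_of_two hn hi'
  · exact kraw_universal_bound_of_three_le hn hw3 hw hi' hwn
end

section
/- Assume c ∈ (0,1) and C0 ≥ 1 are constants such that |K_{w'}(i)| ≤ C0·binom(n,w')·(1 − 2w'/n)^i for all integers 0 ≤ w' ≤ c·n and 0 ≤ i ≤ n/2. Let C be an [n,k] linear binary code with generator matrix G (a k×n matrix over F_2 of rank k whose row space is C) and dual distance d⊥ < n/2; set t⊥ = ⌊(d⊥−1)/2⌋. Let w be an integer with 0 ≤ w ≤ c·n, ε > 0, and let Z be a random vector on F_2^n with pmf P_Z satisfying d_TV(P_{GZ}, U_k) ≤ ε. Then there exists a vector e ∈ F_2^n with |e| = w such that |bias(e·Z)| ≤ sqrt(|C⊥|·V_n(t⊥)/2^{n+1}) + (sqrt(C0·n)/2)·(1 − 2w/n)^{t⊥/2}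 + sqrt(ε/2). -/
open Finset Filter
open scoped Classical BigOperators Topology

/-- The sign character `b ↦ (-1)^b` on `ZMod 2`. -/
noncomputable def sgn (b : ZMod 2) : ℝ := if b = 0 then 1 else -1

lemma zmod_two_eq_one_of_ne_zero {b : ZMod 2} (h : b ≠ 0) : b = 1 := by
  revert b; decide

@[simp] lemma sgn_zero : sgn 0 = 1 := by simp [sgn]

@[simp] lemma sgn_one : sgn 1 = -1 := by simp [sgn]

lemma sgn_add (a b : ZMod 2) : sgn (a + b) = sgn a * sgn b := by
  have h2 : (1 : ZMod 2) + 1 = 0 := by decide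
  by_cases ha : a = 0
  · simp [ha]
  · by_cases hb : b = 0
    · simp [hb]
    · simp [zmod_two_eq_one_of_ne_zero ha, zmod_two_eq_one_of_ne_zero hb, h2]

lemma sgn_sub (a b : ZMod 2) : sgn (a - b) = sgn a * sgn b := by
  rw [CharTwo.sub_eq_add, sgn_add]

lemma sgn_sum {ι : Type*} (s : Finset ι) (f : ι → ZMod 2) :
    sgn (∑ i ∈ s, f i) = ∏ i ∈ s, sgn (f i) := by
  induction s using Finset.induction_on with
  | empty => simp
  | insert a s ha ih => rw [Finset.sum_insert ha, Finset.prod_insert ha, sgn_add, ih]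

lemma abs_sgn (b : ZMod 2) : |sgn b| = 1 := by
  unfold sgn; split_ifs <;> simp

/-- The binary indicator vector of a set of coordinates. -/
noncomputable def indVec {n : ℕ} (s : Finset (Fin n)) : BV n := fun i => if i ∈ s then 1 else 0

lemma wt_indVec {n : ℕ} (s : Finset (Fin n)) : wt (indVec s) = s.card := by
  simp [wt, indVec]

lemma sgn_dotp_indVec {n : ℕ} (s : Finset (Fin n)) (x : BV n) :
    sgn (dotp (indVec s) x) = ∏ i ∈ s, sgn (x i) := by
  rw [← sgn_sum]
  simp [dotp, indVec]

lemma dotp_sub {n : ℕ} (e x y : BV n) : dotp e (x - y) = dotp e x - dotp e y := by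
  simp [dotp, mul_sub]

lemma biasOf_eq {n : ℕ} (e : BV n) {P : BV n → ℝ} (hP : IsPMF P) :
    biasOf e P = (1 / 2) * ∑ z, P z * sgn (dotp e z) := by
  have h (z : BV n) : P z * sgn (dotp e z) = P z - 2 * (if dotp e z = 1 then P z else 0) := by
    by_cases h0 : dotp e z = 0
    · simp [h0]
    · rw [zmod_two_eq_one_of_ne_zero h0]; simp; ring
  rw [Finset.sum_congr rfl fun z _ => h z, Finset.sum_sub_distrib, hP.2, ← Finset.mul_sum,
    ← Finset.sum_filter, biasOf]
  ring

/-- The sum over all vectors `e` of weight `w` of the character `(-1)^(e·x)`. -/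
noncomputable def charSum {n : ℕ} (w : ℕ) (x : BV n) : ℝ :=
  ∑ s ∈ Finset.powersetCard w (Finset.univ : Finset (Fin n)), sgn (dotp (indVec s) x)

open Polynomial in
lemma coeff_prod_one_add_mul_X {n : ℕ} (a : Fin n → ℝ) (w : ℕ) :
    (∏ i, (1 + Polynomial.C (a i) * X)).coeff w =
      ∑ s ∈ Finset.powersetCard w (Finset.univ : Finset (Fin n)), ∏ i ∈ s, a i := by
  rw [Finset.prod_one_add, Polynomial.finsetSum_coeff]
  have h (s : Finset (Fin n)) : (∏ i ∈ s, Polynomial.C (a i) * X).coeff w =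
      if s.card = w then ∏ i ∈ s, a i else 0 := by
    rw [Finset.prod_mul_distrib, Finset.prod_const, ← map_prod, Polynomial.coeff_C_mul,
      Polynomial.coeff_X_pow]
    simp [eq_comm]
  rw [Finset.sum_congr rfl fun s _ => h s, ← Finset.sum_filter]
  congr 1
  ext s
  simp [Finset.mem_powersetCard]

open Polynomial in
lemma coeff_one_sub_X_pow_mul_one_add_X_pow (n w i : ℕ) :
    (((1 : ℝ[X]) + Polynomial.C (-1) * X) ^ i * (1 + X) ^ (n - i)).coeff w = Kraw n w i := by
  have h : ((1 : ℝ[X]) + Polynomial.C (-1) * X) ^ i =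
      ((1 + X) ^ i : ℝ[X]).comp (Polynomial.C (-1) * X) := by simp
  rw [h, Polynomial.coeff_mul, Finset.Nat.sum_antidiagonal_eq_sum_range_succ_mk, Kraw]
  refine Finset.sum_congr rfl fun j _ => ?_
  rw [Polynomial.comp_C_mul_X_coeff, Polynomial.coeff_one_add_X_pow,
    Polynomial.coeff_one_add_X_pow]
  ring

open Polynomial in
lemma charSum_eq_kraw {n : ℕ} (w : ℕ) (x : BV n) : charSum w x = Kraw n w (wt x) := by
  rw [charSum, Finset.sum_congr rfl fun s _ => sgn_dotp_indVec s x, ← coeff_prod_one_add_mul_X,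
    ← coeff_one_sub_X_pow_mul_one_add_X_pow]
  congr 1
  rw [← Finset.prod_filter_mul_prod_filter_not Finset.univ (fun i => x i ≠ 0)]
  congr 1
  · refine Finset.prod_eq_pow_card fun i hi => ?_
    rw [zmod_two_eq_one_of_ne_zero (Finset.mem_filter.1 hi).2, sgn_one]
  · have hcard : (Finset.univ.filter fun i => ¬ x i ≠ 0).card = n - wt x := by
      have := Finset.card_filter_add_card_filter_not (s := Finset.univ) (fun i => x i ≠ 0)
      rw [Finset.card_univ, Fintype.card_fin] at this
      rw [wt]; omega
    rw [← hcard]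
    refine Finset.prod_eq_pow_card fun i hi => ?_
    rw [not_not.1 (Finset.mem_filter.1 hi).2, sgn_zero]
    simp

lemma wt_sub_one {n : ℕ} (x : BV n) : wt (x - 1) + wt x = n := by
  have h : (Finset.univ.filter fun i => (x - 1) i ≠ 0) = Finset.univ.filter fun i => ¬ x i ≠ 0 := by
    ext i
    simp only [Finset.mem_filter, Finset.mem_univ, true_and, Pi.sub_apply, Pi.one_apply]
    generalize x i = b
    revert b; decide
  have := Finset.card_filter_add_card_filter_not (s := Finset.univ) (fun i => x i ≠ 0)
  rw [Finset.card_univ, Fintype.card_fin] at this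
  rw [wt, wt, h]; omega

lemma charSum_sub_one {n : ℕ} (w : ℕ) (x : BV n) : |charSum w (x - 1)| = |charSum w x| := by
  have h : charSum w (x - 1) = charSum w x * (-1) ^ w := by
    rw [charSum, charSum, Finset.sum_mul]
    refine Finset.sum_congr rfl fun s hs => ?_
    rw [sgn_dotp_indVec, sgn_dotp_indVec, ← (Finset.mem_powersetCard.1 hs).2,
      ← Finset.prod_const, ← Finset.prod_mul_distrib]
    exact Finset.prod_congr rfl fun i _ => by simp [sgn_sub]
  rw [h, abs_mul, abs_pow]; simp

lemma abs_charSum_le_choose {n : ℕ} (w : ℕ) (x : BV n) : |charSum w x| ≤ n.choose w := by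
  refine (Finset.abs_sum_le_sum_abs _ _).trans ?_
  simp [abs_sgn]

lemma wt_eq_hammingNorm {n : ℕ} (x : BV n) : wt x = hammingNorm x := by
  simp [wt, hammingNorm]

lemma wt_sub_le {n : ℕ} (x y v : BV n) : wt (x - y) ≤ wt (x - v) + wt (y - v) := by
  have h (a b : BV n) : wt (a - b) = hammingDist a b := by simp [wt, hammingDist, sub_eq_zero]
  simpa only [h] using hammingDist_triangle_right x y v

lemma card_ball_le {n : ℕ} (v : BV n) (t : ℕ) :
    (Finset.univ.filter fun z : BV n => wt (z - v) ≤ t).card ≤ Vball n t := by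
  have hle : (Finset.univ.filter fun z : BV n => wt (z - v) ≤ t).card ≤
      ((Finset.range (t + 1)).biUnion fun j =>
        Finset.powersetCard j (Finset.univ : Finset (Fin n))).card := by
    refine Finset.card_le_card_of_injOn
      (fun z => Finset.univ.filter fun i => (z - v) i ≠ 0) ?_ ?_
    · intro z hz
      have hz' : wt (z - v) ≤ t := by simpa using hz
      simpa [Finset.mem_powersetCard, Nat.lt_succ_iff, wt] using hz'
    · intro x _ y _ hxy
      funext i
      have hi : ((x - v) i ≠ 0) ↔ ((y - v) i ≠ 0) := by
        simpa using Finset.ext_iff.1 hxy i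
      simp only [Pi.sub_apply] at hi
      generalize x i = a, y i = b, v i = d at hi
      revert a b d; decide
  refine hle.trans (Finset.card_biUnion_le.trans ?_)
  simp [Vball]

lemma sum_sub_le_dTV {α : Type*} [Fintype α] (p q : α → ℝ) (h : ∑ x, p x = ∑ x, q x)
    (B : Finset α) : ∑ x ∈ B, (p x - q x) ≤ dTV p q := by
  have h1 : ∑ x ∈ B, (p x - q x) + ∑ x ∈ Bᶜ, (p x - q x) = 0 := by
    rw [Finset.sum_add_sum_compl, Finset.sum_sub_distrib, h, sub_self]
  have h2 : ∑ x ∈ B, |p x - q x| + ∑ x ∈ Bᶜ, |p x - q x| = ∑ x, |p x - q x| :=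
    Finset.sum_add_sum_compl _ _
  have h3 : ∑ x ∈ B, (p x - q x) ≤ ∑ x ∈ B, |p x - q x| :=
    Finset.sum_le_sum fun x _ => le_abs_self _
  have h4 : -∑ x ∈ Bᶜ, (p x - q x) ≤ ∑ x ∈ Bᶜ, |p x - q x| := by
    rw [← Finset.sum_neg_distrib]
    exact Finset.sum_le_sum fun x _ => neg_le_abs _
  rw [dTV]; linarith

lemma sum_pmfMap {k n : ℕ} (G : Matrix (Fin k) (Fin n) (ZMod 2)) (P : BV n → ℝ) :
    ∑ u, pmfMap G P u = ∑ z, P z :=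
  Finset.sum_fiberwise _ _ _

lemma sum_le_of_injOn {k n : ℕ} (G : Matrix (Fin k) (Fin n) (ZMod 2)) {P : BV n → ℝ}
    (hP : IsPMF P) (A : Finset (BV n)) (hA : Set.InjOn (fun z => G.mulVec z) (A : Set (BV n))) :
    ∑ z ∈ A, P z ≤ A.card / 2 ^ k + dTV (pmfMap G P) (unif (BV k)) := by
  have hsum : ∑ u, pmfMap G P u = ∑ u, unif (BV k) u := by
    rw [sum_pmfMap, hP.2]
    simp [unif, ZMod.card]
  have h1 := sum_sub_le_dTV _ _ hsum (A.image fun z => G.mulVec z)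
  have h2 : ∑ u ∈ A.image (fun z => G.mulVec z), unif (BV k) u = A.card / 2 ^ k := by
    rw [Finset.sum_image hA]
    simp [unif, ZMod.card, div_eq_mul_inv]
  have h3 : ∑ z ∈ A, P z ≤ ∑ u ∈ A.image (fun z => G.mulVec z), pmfMap G P u := by
    rw [Finset.sum_image hA]
    refine Finset.sum_le_sum fun z _ => ?_
    exact Finset.single_le_sum (f := P) (fun y _ => hP.1 y)
      (Finset.mem_filter.2 ⟨Finset.mem_univ z, rfl⟩)
  rw [Finset.sum_sub_distrib, h2] at h1
  linarith

lemma mem_dualSet_rowSpan_iff {k n : ℕ} (G : Matrix (Fin k) (Fin n) (ZMod 2)) (y : BV n) :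
    y ∈ dualSet ((rowSpan G : Submodule (ZMod 2) (BV n)) : Set (BV n)) ↔ G.mulVec y = 0 := by
  constructor
  · intro h
    funext i
    have := h (G i) (Submodule.subset_span ⟨i, rfl⟩)
    simpa [Matrix.mulVec, dotProduct, dotp, mul_comm] using this
  · intro h c hc
    induction hc using Submodule.span_induction with
    | mem x hx =>
      obtain ⟨i, rfl⟩ := hx
      have := congrFun h i
      simpa [Matrix.mulVec, dotProduct, dotp, mul_comm] using this
    | zero => simp [dotp]
    | add a b _ _ ha hb =>
      have : dotp y (a + b) = dotp y a + dotp y b := by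
        simp [dotp, mul_add, Finset.sum_add_distrib]
      rw [this, ha, hb, add_zero]
    | smul r a _ ha =>
      have : dotp y (r • a) = r * dotp y a := by
        simp [dotp, Finset.mul_sum, mul_left_comm]
      rw [this, ha, mul_zero]

lemma card_dualSet_rowSpan {k n : ℕ} (G : Matrix (Fin k) (Fin n) (ZMod 2)) (hrank : G.rank = k) :
    Nat.card (dualSet ((rowSpan G : Submodule (ZMod 2) (BV n)) : Set (BV n))) * 2 ^ k
      = 2 ^ n := by
  have hset : dualSet ((rowSpan G : Submodule (ZMod 2) (BV n)) : Set (BV n)) =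
      (LinearMap.ker G.mulVecLin : Set (BV n)) := by
    ext y
    rw [mem_dualSet_rowSpan_iff]; simp
  have hcard : Nat.card (LinearMap.ker G.mulVecLin : Set (BV n)) =
      2 ^ Module.finrank (ZMod 2) (LinearMap.ker G.mulVecLin) := by
    have := Module.natCard_eq_pow_finrank (K := ZMod 2) (V := LinearMap.ker G.mulVecLin)
    simpa [Nat.card_zmod] using this
  have hrn := LinearMap.finrank_range_add_finrank_ker G.mulVecLin
  rw [Module.finrank_fin_fun] at hrn
  change G.rank + _ = n at hrn
  rw [hset, hcard, ← pow_add]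
  congr 1
  omega

lemma mulVec_injOn_ball {k n d : ℕ} (G : Matrix (Fin k) (Fin n) (ZMod 2)) (hd : 0 < d)
    (hmin : ∀ y : BV n, G.mulVec y = 0 → y ≠ 0 → d ≤ wt y) (v : BV n) :
    Set.InjOn (fun z => G.mulVec z)
      ((Finset.univ.filter fun z : BV n => wt (z - v) ≤ (d - 1) / 2 : Finset (BV n)) :
        Set (BV n)) := by
  intro x hx y hy hxy
  by_contra hne
  have hx' : wt (x - v) ≤ (d - 1) / 2 := by simpa using hx
  have hy' : wt (y - v) ≤ (d - 1) / 2 := by simpa using hy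
  have hxy' : G.mulVec x = G.mulVec y := hxy
  have := hmin (x - y) (by rw [Matrix.mulVec_sub, hxy', sub_self]) (sub_ne_zero.2 hne)
  have := wt_sub_le x y v
  omega

lemma sum_four_mul_biasOf_sq {n : ℕ} (w : ℕ) {P : BV n → ℝ} (hP : IsPMF P) :
    ∑ s ∈ Finset.powersetCard w (Finset.univ : Finset (Fin n)), 4 * biasOf (indVec s) P ^ 2 =
      ∑ z, P z * ∑ y, P y * charSum w (y - z) := by
  have h (s : Finset (Fin n)) : 4 * biasOf (indVec s) P ^ 2 =
      ∑ z, ∑ y, P z * (P y * sgn (dotp (indVec s) (y - z))) := by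
    rw [biasOf_eq _ hP, mul_pow, ← mul_assoc, sq (∑ z, _), Finset.sum_mul_sum]
    norm_num
    refine Finset.sum_congr rfl fun z _ => Finset.sum_congr rfl fun y _ => ?_
    rw [dotp_sub, sgn_sub]; ring
  rw [Finset.sum_congr rfl fun s _ => h s, Finset.sum_comm]
  refine Finset.sum_congr rfl fun z _ => ?_
  rw [Finset.sum_comm, Finset.mul_sum]
  refine Finset.sum_congr rfl fun y _ => ?_
  rw [charSum, Finset.mul_sum, Finset.mul_sum]

lemma abs_charSum_le_of_kraw {n w t : ℕ} {C0 r : ℝ} (hC0 : 0 ≤ C0) (hr0 : 0 ≤ r) (hr1 : r ≤ 1)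
    (hK : ∀ i : ℕ, (i : ℝ) ≤ (n : ℝ) / 2 → |Kraw n w i| ≤ C0 * (n.choose w : ℝ) * r ^ i)
    (x : BV n) :
    |charSum w x| ≤ n.choose w *
      ((if wt x ≤ t then 1 else 0) + (if wt (x - 1) ≤ t then 1 else 0) + C0 * r ^ t) := by
  have hN : (0 : ℝ) ≤ n.choose w := Nat.cast_nonneg _
  have hrt : 0 ≤ C0 * r ^ t := by positivity
  have hbase := abs_charSum_le_choose w x
  by_cases h1 : wt x ≤ t
  · rw [if_pos h1]
    refine hbase.trans (le_mul_of_one_le_right hN ?_)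
    split_ifs <;> linarith
  by_cases h2 : wt (x - 1) ≤ t
  · rw [if_pos h2]
    refine hbase.trans (le_mul_of_one_le_right hN ?_)
    split_ifs; linarith
  rw [if_neg h1, if_neg h2, zero_add, zero_add]
  have key (y : BV n) (hy : t ≤ wt y) (hyn : (wt y : ℝ) ≤ n / 2) :
      |charSum w y| ≤ n.choose w * (C0 * r ^ t) := by
    rw [charSum_eq_kraw]
    refine (hK _ hyn).trans ?_
    calc C0 * (n.choose w : ℝ) * r ^ wt y ≤ C0 * (n.choose w : ℝ) * r ^ t := by
          gcongr ?_ * ?_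
          exact pow_le_pow_of_le_one hr0 hr1 hy
      _ = _ := by ring
  have hsum : (wt (x - 1) : ℝ) + wt x = n := by exact_mod_cast wt_sub_one x
  rcases le_total (wt x : ℝ) (n / 2) with h | h
  · exact key x (by omega) h
  · rw [← charSum_sub_one]
    exact key _ (by omega) (by linarith)

lemma exists_biasOf_sq_le {n w t : ℕ} {C0 r M : ℝ} (hwn : w ≤ n) (hC0 : 0 ≤ C0) (hr0 : 0 ≤ r)
    (hr1 : r ≤ 1)
    (hK : ∀ i : ℕ, (i : ℝ) ≤ (n : ℝ) / 2 → |Kraw n w i| ≤ C0 * (n.choose w : ℝ) * r ^ i)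
    {P : BV n → ℝ} (hP : IsPMF P)
    (hM : ∀ v : BV n, ∑ z ∈ Finset.univ.filter (fun z => wt (z - v) ≤ t), P z ≤ M) :
    ∃ e : BV n, wt e = w ∧ biasOf e P ^ 2 ≤ (2 * M + C0 * r ^ t) / 4 := by
  have hne : (Finset.powersetCard w (Finset.univ : Finset (Fin n))).Nonempty := by
    rw [Finset.powersetCard_nonempty]; simpa using hwn
  have hN : (0 : ℝ) ≤ n.choose w := Nat.cast_nonneg _
  have hinner (z : BV n) : ∑ y, P y * charSum w (y - z) ≤
      n.choose w * (2 * M + C0 * r ^ t) := by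
    have hone (y : BV n) : y - z - 1 = y - (z + 1) := by abel
    calc ∑ y, P y * charSum w (y - z)
        ≤ ∑ y, n.choose w * ((if wt (y - z) ≤ t then P y else 0) +
            (if wt (y - (z + 1)) ≤ t then P y else 0) + P y * (C0 * r ^ t)) := by
          refine Finset.sum_le_sum fun y _ => ?_
          have h := (le_abs_self _).trans
            (abs_charSum_le_of_kraw (t := t) hC0 hr0 hr1 hK (y - z))
          rw [hone] at h
          refine (mul_le_mul_of_nonneg_left h (hP.1 y)).trans_eq ?_
          split_ifs <;> ring
      _ = n.choose w * (∑ y ∈ Finset.univ.filter (fun y => wt (y - z) ≤ t), P y +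
            ∑ y ∈ Finset.univ.filter (fun y => wt (y - (z + 1)) ≤ t), P y + C0 * r ^ t) := by
          rw [← Finset.mul_sum, Finset.sum_add_distrib, Finset.sum_add_distrib,
            ← Finset.sum_mul, hP.2, one_mul, Finset.sum_filter, Finset.sum_filter]
      _ ≤ _ := by
          gcongr
          linarith [hM z, hM (z + 1)]
  have htotal : ∑ s ∈ Finset.powersetCard w (Finset.univ : Finset (Fin n)),
      4 * biasOf (indVec s) P ^ 2 ≤
      ∑ _s ∈ Finset.powersetCard w (Finset.univ : Finset (Fin n)), (2 * M + C0 * r ^ t) := by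
    rw [sum_four_mul_biasOf_sq w hP, Finset.sum_const, Finset.card_powersetCard,
      Finset.card_univ, Fintype.card_fin, nsmul_eq_mul]
    calc ∑ z, P z * ∑ y, P y * charSum w (y - z)
        ≤ ∑ z, P z * (n.choose w * (2 * M + C0 * r ^ t)) :=
          Finset.sum_le_sum fun z _ => mul_le_mul_of_nonneg_left (hinner z) (hP.1 z)
      _ = _ := by rw [← Finset.sum_mul, hP.2, one_mul]
  obtain ⟨s, hs, hle⟩ := Finset.exists_le_of_sum_le hne htotal
  exact ⟨indVec s, by rw [wt_indVec, (Finset.mem_powersetCard.1 hs).2], by linarith⟩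

lemma abs_le_sqrt_add_sqrt_add_sqrt {x a b c : ℝ} (ha : 0 ≤ a) (hb : 0 ≤ b) (hc : 0 ≤ c)
    (h : x ^ 2 ≤ a + b + c) : |x| ≤ Real.sqrt a + Real.sqrt b + Real.sqrt c := by
  refine abs_le_of_sq_le_sq (h.trans ?_) (by positivity)
  have := Real.sq_sqrt ha
  have := Real.sq_sqrt hb
  have := Real.sq_sqrt hc
  nlinarith [mul_nonneg (Real.sqrt_nonneg a) (Real.sqrt_nonneg b),
    mul_nonneg (Real.sqrt_nonneg a) (Real.sqrt_nonneg c),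
    mul_nonneg (Real.sqrt_nonneg b) (Real.sqrt_nonneg c)]

lemma one_sub_nonneg_of_kraw_bound {n w : ℕ} {C0 : ℝ} (hC0 : 0 < C0) (hn : 2 ≤ n) (hwn : w ≤ n)
    (hK : ∀ i : ℕ, (i : ℝ) ≤ (n : ℝ) / 2 →
      |Kraw n w i| ≤ C0 * (n.choose w : ℝ) * (1 - 2 * w / n) ^ i) :
    (0 : ℝ) ≤ 1 - 2 * w / n := by
  have hn' : (2 : ℝ) ≤ n := by exact_mod_cast hn
  have h := (abs_nonneg _).trans (hK 1 (by push_cast; linarith))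
  rw [pow_one] at h
  have hN : (0 : ℝ) < n.choose w := by exact_mod_cast Nat.choose_pos hwn
  exact nonneg_of_mul_nonneg_right h (by positivity)

theorem exists_low_bias_error_vector (n k : ℕ) (c C0 : ℝ)
    (hc : c ∈ Set.Ioo (0 : ℝ) 1) (hC0 : 1 ≤ C0)
    (hK : ∀ w i : ℕ, (w : ℝ) ≤ c * n → (i : ℝ) ≤ (n : ℝ) / 2 →
      |Kraw n w i| ≤ C0 * (n.choose w : ℝ) * (1 - 2 * w / n) ^ i)
    (G : Matrix (Fin k) (Fin n) (ZMod 2)) (hrank : G.rank = k)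
    (dperp : ℕ)
    (hdperp : IsLeast
      {m : ℕ | ∃ y ∈ dualSet ((rowSpan G : Submodule (ZMod 2) (BV n)) : Set (BV n)),
        y ≠ 0 ∧ wt y = m} dperp)
    (hdn : (dperp : ℝ) < (n : ℝ) / 2)
    (w : ℕ) (hw : (w : ℝ) ≤ c * n) (ε : ℝ) (hε : 0 < ε)
    (P : BV n → ℝ) (hP : IsPMF P)
    (ht : dTV (pmfMap G P) (unif (BV k)) ≤ ε) :
    ∃ e : BV n, wt e = w ∧
      |biasOf e P| ≤
        Real.sqrt ((Nat.card (dualSet ((rowSpan G : Submodule (ZMod 2) (BV n)) : Set (BV n))) : ℝ)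
            * (Vball n ((dperp - 1) / 2) : ℝ) / 2 ^ (n + 1))
          + Real.sqrt (C0 * n) / 2 * Real.sqrt ((1 - 2 * w / n) ^ ((dperp - 1) / 2))
          + Real.sqrt (ε / 2) := by
  obtain ⟨⟨y, hy, hy0, hyd⟩, hlb⟩ := hdperp
  have hd : 0 < dperp := by
    rw [← hyd, wt_eq_hammingNorm]
    exact hammingNorm_pos_iff.2 hy0
  have hmin (y : BV n) (hGy : G.mulVec y = 0) (hne : y ≠ 0) : dperp ≤ wt y :=
    hlb ⟨y, (mem_dualSet_rowSpan_iff G y).2 hGy, hne, rfl⟩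
  have hd1 : (1 : ℝ) ≤ dperp := by exact_mod_cast hd
  have hn2' : (2 : ℝ) ≤ n := by linarith
  have hn2 : 2 ≤ n := by exact_mod_cast hn2'
  have hwn : w ≤ n := by
    have : (w : ℝ) ≤ n := hw.trans (by nlinarith [hc.2])
    exact_mod_cast this
  have hr0 := one_sub_nonneg_of_kraw_bound (by linarith) hn2 hwn fun i => hK w i hw
  have hr1 : (1 : ℝ) - 2 * w / n ≤ 1 := sub_le_self _ (by positivity)
  set t := (dperp - 1) / 2 with ht_def
  set r : ℝ := 1 - 2 * w / n with hr_def
  have hM (v : BV n) : ∑ z ∈ Finset.univ.filter (fun z => wt (z - v) ≤ t), P z ≤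
      Vball n t / 2 ^ k + ε := by
    refine (sum_le_of_injOn G hP _ (mulVec_injOn_ball G hd hmin v)).trans ?_
    gcongr
    exact card_ball_le v t
  obtain ⟨e, he, hbias⟩ :=
    exists_biasOf_sq_le hwn (by linarith) hr0 hr1 (fun i => hK w i hw) hP hM
  refine ⟨e, he, ?_⟩
  have hcard : (Nat.card (dualSet ((rowSpan G : Submodule (ZMod 2) (BV n)) : Set (BV n))) : ℝ)
      * (Vball n t : ℝ) / 2 ^ (n + 1) = Vball n t / 2 ^ k / 2 := by
    have h : (Nat.card (dualSet ((rowSpan G : Submodule (ZMod 2) (BV n)) : Set (BV n))) : ℝ)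
        * 2 ^ k = 2 ^ n := by exact_mod_cast card_dualSet_rowSpan G hrank
    rw [pow_succ, ← h]
    have : (Nat.card (dualSet ((rowSpan G : Submodule (ZMod 2) (BV n)) : Set (BV n))) : ℝ) ≠ 0 := by
      intro h0
      rw [h0, zero_mul] at h
      exact (pow_pos (two_pos : (0 : ℝ) < 2) n).ne h
    field_simp
  have hmid : Real.sqrt (C0 * n) / 2 * Real.sqrt (r ^ t) = Real.sqrt (C0 * n * r ^ t / 4) := by
    rw [Real.sqrt_div' _ (by norm_num : (0 : ℝ) ≤ 4), Real.sqrt_mul (show 0 ≤ C0 * n by positivity),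
      show (4 : ℝ) = 2 ^ 2 by norm_num, Real.sqrt_sq (by norm_num)]
    ring
  rw [hcard, hmid]
  refine abs_le_sqrt_add_sqrt_add_sqrt (by positivity) (by positivity) (by positivity) ?_
  have hCr : C0 * r ^ t ≤ C0 * n * r ^ t := by
    gcongr
    exact le_mul_of_one_le_right (by linarith) (by linarith)
  linarith
end
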